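/- arXiv:2008.13124 — 2 statements merged into one kernel-verified Lean document; each statement's English description precedes it below -/
import Mathlib

section
/- For Re(p) > 1/2, ₁F₁(p; 2p; 2iX) = Γ(p+1/2)·(X/2)^{-p+1/2}·e^{iX}·J_{p-1/2}(X), where J_ν is the Bessel function of the first kind. -/
open Complex

/-- Rising factorial (Pochhammer symbol) for a complex argument. -/
noncomputable def poch (x : ℂ) (n : ℕ) : ℂ := ∏ i ∈ Finset.range n, (x + i)

/-- Kummer confluent hypergeometric series. -/
noncomputable def oneF1 (a c z : ℂ) : ℂ :=
  ∑' n : ℕ, poch a n / (poch c n * (n.factorial : ℂ)) * z ^ n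

/-- Bessel function of the first kind of (complex) order `ν`, at `X > 0`. -/
noncomputable def besselJ (ν : ℂ) (X : ℝ) : ℂ :=
  ∑' m : ℕ, (-1) ^ m / ((m.factorial : ℂ) * Complex.Gamma ((m : ℂ) + ν + 1)) *
    ((X : ℂ) / 2) ^ (2 * (m : ℂ) + ν)

lemma one_le_norm_poch (q : ℂ) (hq : 1 ≤ q.re) (m : ℕ) : 1 ≤ ‖poch q m‖ := by
  induction m with
  | zero => simp [poch]
  | succ i ih =>
  have hs : poch q (i + 1) = poch q i * (q + i) := by
    unfold poch
    rw [Finset.prod_range_succ]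
  rw [hs, norm_mul]
  refine one_le_mul_of_one_le_of_one_le ih ?_
  refine le_trans ?_ (Complex.re_le_norm _)
  simp only [add_re, natCast_re]
  have : (0 : ℝ) ≤ i := Nat.cast_nonneg i
  linarith

lemma poch_ne_zero (q : ℂ) (hq : 1 ≤ q.re) (m : ℕ) : poch q m ≠ 0 := by
  intro h
  have := one_le_norm_poch q hq m
  rw [h] at this
  norm_num at this

lemma poch_succ (q : ℂ) (m : ℕ) : poch q (m + 1) = poch q m * (q + m) := by
  unfold poch
  rw [Finset.prod_range_succ]

lemma Gamma_add_nat_poch (q : ℂ) (hq : 1 ≤ q.re) (m : ℕ) :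
    Complex.Gamma (m + q) = Complex.Gamma q * poch q m := by
  induction m with
  | zero => simp [poch]
  | succ k ih =>
    have hne : (k : ℂ) + q ≠ 0 := by
      intro h
      have h2 := congrArg Complex.re h
      simp only [add_re, natCast_re, zero_re] at h2
      have : (0 : ℝ) ≤ k := Nat.cast_nonneg k
      linarith
    rw [poch_succ]
    have : ((k + 1 : ℕ) : ℂ) + q = (k + q) + 1 := by push_cast; ring
    rw [this, Complex.Gamma_add_one _ hne, ih]
    ring

/-- coefficients of the even Bessel-type series -/
noncomputable def gco (q : ℂ) (n : ℕ) : ℂ :=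
  if Even n then 1 / (4 ^ (n / 2) * ((n / 2).factorial : ℂ) * poch q (n / 2)) else 0

lemma gco_even (q : ℂ) (m : ℕ) :
    gco q (2 * m) = 1 / (4 ^ m * (m.factorial : ℂ) * poch q m) := by
  simp [gco]

lemma gco_odd (q : ℂ) (m : ℕ) : gco q (2 * m + 1) = 0 := by
  simp [gco]

lemma gco_rec (p : ℂ) (hp : 1 / 2 < p.re) (n : ℕ) :
    ((n : ℂ) + 2) * (n + 1 + 2 * p) * gco (p + 1 / 2) (n + 2) = gco (p + 1 / 2) n := by
  rcases Nat.even_or_odd' n with ⟨m, rfl | rfl⟩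
  · have hq : 1 ≤ (p + 1 / 2).re := by
      simp only [add_re]; norm_num; linarith
    have h0 := poch_ne_zero _ hq (m + 1)
    rw [poch_succ] at h0
    have h1 := left_ne_zero_of_mul h0
    have h2 := right_ne_zero_of_mul h0
    have h3 : (m.factorial : ℂ) ≠ 0 := by exact_mod_cast m.factorial_ne_zero
    have h4 : ((m : ℂ) + 1) ≠ 0 := by exact_mod_cast m.succ_ne_zero
    rw [show 2 * m + 2 = 2 * (m + 1) by ring, gco_even, gco_even, poch_succ, Nat.factorial_succ]
    push_cast
    rw [mul_one_div, div_eq_div_iff]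
    · ring
    · exact mul_ne_zero (mul_ne_zero (pow_ne_zero _ (by norm_num)) (mul_ne_zero h4 h3)) (mul_ne_zero h1 h2)
    · exact mul_ne_zero (mul_ne_zero (pow_ne_zero _ (by norm_num)) h3) h1
  · rw [show 2 * m + 1 + 2 = 2 * (m + 1) + 1 by ring, gco_odd, gco_odd, mul_zero]

lemma ode_G (p : ℂ) (hp : 1 / 2 < p.re) (G : PowerSeries ℂ)
    (hG : G = PowerSeries.mk (gco (p + 1 / 2))) :
    PowerSeries.X * PowerSeries.derivative ℂ (PowerSeries.derivative ℂ G)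
      + PowerSeries.C (2 * p) * PowerSeries.derivative ℂ G - PowerSeries.X * G = 0 := by
  ext n
  rcases n with _ | n
  · have : gco (p + 1 / 2) 1 = 0 := gco_odd _ 0
    simp only [map_sub, map_add, PowerSeries.coeff_zero_X_mul, PowerSeries.coeff_C_mul,
      PowerSeries.coeff_derivative, hG, PowerSeries.coeff_mk, map_zero, zero_add, this]
    ring
  · have := gco_rec p hp n
    simp only [map_sub, map_add, PowerSeries.coeff_succ_X_mul, PowerSeries.coeff_C_mul,
      PowerSeries.coeff_derivative, hG, PowerSeries.coeff_mk, map_zero]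
    push_cast
    rw [← this]
    ring

lemma coeff_identity (p : ℂ) (hp : 1 / 2 < p.re) (n : ℕ) :
    PowerSeries.coeff n (PowerSeries.exp ℂ * PowerSeries.mk (gco (p + 1 / 2)))
      = 2 ^ n * poch p n / (poch (2 * p) n * (n.factorial : ℂ)) := by
  obtain ⟨G, hG⟩ : ∃ G, G = PowerSeries.mk (gco (p + 1 / 2)) := ⟨_, rfl⟩
  have ode := ode_G p hp G hG
  rw [← hG]
  obtain ⟨F, hF⟩ : ∃ F, F = PowerSeries.exp ℂ * G := ⟨_, rfl⟩
  have hE : PowerSeries.derivative ℂ (PowerSeries.exp ℂ) = PowerSeries.exp ℂ := by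
    ext n
    simp only [PowerSeries.coeff_derivative, PowerSeries.coeff_exp, Nat.factorial_succ]
    have h4 : ((n : ℂ) + 1) ≠ 0 := by exact_mod_cast n.succ_ne_zero
    have h3 : (n.factorial : ℂ) ≠ 0 := by exact_mod_cast n.factorial_ne_zero
    simp
    field_simp
  have odeF : PowerSeries.X * PowerSeries.derivative ℂ (PowerSeries.derivative ℂ F)
      + (PowerSeries.C (2 * p) - PowerSeries.C 2 * PowerSeries.X) * PowerSeries.derivative ℂ F
      - PowerSeries.C (2 * p) * F = 0 := by
    have h2 : (PowerSeries.C (2 : ℂ)) = (2 : PowerSeries ℂ) := map_ofNat _ 2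
    have : PowerSeries.derivative ℂ F = PowerSeries.exp ℂ * (G + PowerSeries.derivative ℂ G) := by
      rw [hF, Derivation.leibniz, hE]; simp only [smul_eq_mul]; ring
    have h3 : PowerSeries.derivative ℂ (PowerSeries.derivative ℂ F) = PowerSeries.exp ℂ *
        (G + 2 * PowerSeries.derivative ℂ G
          + PowerSeries.derivative ℂ (PowerSeries.derivative ℂ G)) := by
      rw [this, Derivation.leibniz, hE, map_add]; simp only [smul_eq_mul]; ring
    rw [h3, this, hF, h2]
    linear_combination (PowerSeries.exp ℂ) * ode
  rw [← hF]
  have h2p : 1 ≤ (2 * p).re := by simp; linarith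
  induction n with
  | zero =>
    have : gco (p + 1 / 2) 0 = 1 := by simp [gco, poch]
    rw [hF, hG, PowerSeries.coeff_mul]
    simp only [Finset.Nat.antidiagonal_zero, Finset.sum_singleton, PowerSeries.coeff_mk, this]
    simp [poch]
  | succ n ih =>
    have hp0 := poch_ne_zero _ h2p (n + 1)
    rw [poch_succ] at hp0
    have h1 := left_ne_zero_of_mul hp0
    have h2 := right_ne_zero_of_mul hp0
    have h3 : (n.factorial : ℂ) ≠ 0 := by exact_mod_cast n.factorial_ne_zero
    have h4 : ((n : ℂ) + 1) ≠ 0 := by exact_mod_cast n.succ_ne_zero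
    have key : ((n : ℂ) + 1) * (2 * p + n) * PowerSeries.coeff (n + 1) F
        = 2 * (p + n) * PowerSeries.coeff n F := by
      have hc := congrArg (PowerSeries.coeff n) odeF
      rw [sub_mul, mul_assoc (PowerSeries.C (2 : ℂ))] at hc
      rcases n with _ | k
      · simp only [map_sub, map_add, PowerSeries.coeff_zero_X_mul, PowerSeries.coeff_C_mul,
          PowerSeries.coeff_derivative, map_zero, zero_add] at hc
        push_cast at hc ⊢
        simp only [zero_add] at hc ⊢
        linear_combination hc
      · simp only [map_sub, map_add, PowerSeries.coeff_succ_X_mul, PowerSeries.coeff_C_mul,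
          PowerSeries.coeff_derivative, map_zero] at hc
        push_cast at hc ⊢
        linear_combination hc
    apply mul_left_cancel₀ (mul_ne_zero h4 h2)
    rw [key, ih, poch_succ, poch_succ, Nat.factorial_succ]
    push_cast
    field_simp
    ring

lemma two_mul_inj : Function.Injective (fun m : ℕ => 2 * m) := by
  intro a b h
  simp only at h
  omega

lemma summable_g (q : ℂ) (hq : 1 ≤ q.re) (z : ℂ) : Summable fun n => ‖gco q n * z ^ n‖ := by
  rw [← two_mul_inj.summable_iff]
  · refine Summable.of_nonneg_of_le (fun _ => norm_nonneg _) ?_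
      (Real.summable_pow_div_factorial (‖z‖ ^ 2))
    intro m
    have hP := one_le_norm_poch q hq m
    simp only [Function.comp, gco_even]
    rw [norm_mul, norm_div, norm_mul, norm_mul, norm_pow, norm_pow, norm_one, pow_mul,
      Complex.norm_natCast, one_div, inv_mul_eq_div]
    have hf : (0 : ℝ) < m.factorial := by exact_mod_cast m.factorial_pos
    apply div_le_div_of_nonneg_left (by positivity) hf
    have h4 : (1 : ℝ) ≤ ‖(4 : ℂ)‖ ^ m := one_le_pow₀ (by norm_num)
    calc (m.factorial : ℝ) = 1 * m.factorial * 1 := by ring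
      _ ≤ _ := by gcongr
  · intro n hn
    rcases Nat.even_or_odd' n with ⟨m, rfl | rfl⟩
    · exact absurd ⟨m, rfl⟩ hn
    · simp [gco_odd]

lemma oneF1_eq_exp_mul (p : ℂ) (hp : 1 / 2 < p.re) (z : ℂ) :
    oneF1 p (2 * p) (2 * z) = Complex.exp z *
      ∑' m : ℕ, 1 / (4 ^ m * (m.factorial : ℂ) * poch (p + 1 / 2) m) * z ^ (2 * m) := by
  have hq : 1 ≤ (p + 1 / 2).re := by
    simp only [add_re]; norm_num; linarith
  have hg := summable_g _ hq z
  have he : Summable fun n : ℕ => ‖z ^ n / (n.factorial : ℂ)‖ :=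
    NormedSpace.norm_expSeries_div_summable z
  have hgs : ∑' n, gco (p + 1 / 2) n * z ^ n =
      ∑' m : ℕ, 1 / (4 ^ m * (m.factorial : ℂ) * poch (p + 1 / 2) m) * z ^ (2 * m) := by
    rw [← two_mul_inj.tsum_eq]
    · simp only [gco_even]
    · intro n hn
      rcases Nat.even_or_odd' n with ⟨m, rfl | rfl⟩
      · exact ⟨m, rfl⟩
      · simp [gco_odd] at hn
  have hes : Complex.exp z = ∑' n : ℕ, z ^ n / (n.factorial : ℂ) := by
    rw [Complex.exp_eq_exp_ℂ, NormedSpace.exp_eq_tsum_div]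
  rw [← hgs, hes, tsum_mul_tsum_eq_tsum_sum_antidiagonal_of_summable_norm he hg]
  unfold oneF1
  congr 1
  ext n
  have h := coeff_identity p hp n
  rw [PowerSeries.coeff_mul] at h
  calc _ = (2 ^ n * poch p n / (poch (2 * p) n * (n.factorial : ℂ))) * z ^ n := by
        rw [mul_pow]; ring
    _ = _ := by
        rw [← h, Finset.sum_mul]
        refine Finset.sum_congr rfl fun kl hkl => ?_
        rw [← Finset.HasAntidiagonal.mem_antidiagonal.mp hkl, pow_add]
        simp only [PowerSeries.coeff_exp, PowerSeries.coeff_mk]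
        simp
        ring

/-- `₁F₁(p; 2p; 2iX) = Γ(p+1/2)(X/2)^{-p+1/2} e^{iX} J_{p-1/2}(X)`. -/
theorem oneF1_eq_besselJ (p : ℂ) (hp : 1 / 2 < p.re) (X : ℝ) (hX : 0 < X) :
    oneF1 p (2 * p) (2 * I * X)
      = Complex.Gamma (p + 1 / 2) * ((X : ℂ) / 2) ^ (-p + 1 / 2) *
          Complex.exp (I * X) * besselJ (p - 1 / 2) X := by
  have hq : 1 ≤ (p + 1 / 2).re := by
    simp only [add_re]; norm_num; linarith
  rw [mul_assoc 2 I, oneF1_eq_exp_mul p hp]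
  unfold besselJ
  rw [mul_comm (_ * _) (Complex.exp _), mul_assoc (Complex.exp _)]
  congr 1
  rw [← tsum_mul_left]
  refine tsum_congr fun m => ?_
  have hX2 : (X : ℂ) / 2 ≠ 0 := by
    have : (X : ℂ) ≠ 0 := by exact_mod_cast hX.ne'
    simpa using this
  have hG : Complex.Gamma (p + 1 / 2) ≠ 0 := Complex.Gamma_ne_zero_of_re_pos (by linarith)
  have hP := poch_ne_zero _ hq m
  have h3 : (m.factorial : ℂ) ≠ 0 := by exact_mod_cast m.factorial_ne_zero
  have hpow : ((X : ℂ) / 2) ^ (-p + 1 / 2) * ((X : ℂ) / 2) ^ (2 * (m : ℂ) + (p - 1 / 2))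
      = ((X : ℂ) / 2) ^ (2 * m) := by
    rw [← Complex.cpow_add _ _ hX2, ← Complex.cpow_natCast]
    congr 1
    push_cast
    ring
  rw [show (m : ℂ) + (p - 1 / 2) + 1 = m + (p + 1 / 2) by ring, Gamma_add_nat_poch _ hq]
  have hI : (I * (X : ℂ)) ^ (2 * m) = (-1) ^ m * 4 ^ m * ((X : ℂ) / 2) ^ (2 * m) := by
    rw [pow_mul, pow_mul, ← mul_pow, ← mul_pow]
    congr 1
    rw [mul_pow, I_sq]
    ring
  rw [hI, ← hpow]
  have h4 : (4 : ℂ) ^ m ≠ 0 := pow_ne_zero _ (by norm_num)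
  generalize ((X : ℂ) / 2) ^ (-p + 1 / 2) = A
  generalize ((X : ℂ) / 2) ^ (2 * (m : ℂ) + (p - 1 / 2)) = B
  generalize poch (p + 1 / 2) m = P at *
  generalize Complex.Gamma (p + 1 / 2) = Q at *
  field_simp
end

section
/- The integral ∫_{-∞}^∞ ω₁(t) dt with ω₁(t) = (1-it)^{(c-1)/2}(1+it)^{(c̄-1)/2}, c = -p + iq, p > 1, equals 2^{1-p} π Γ(p) / (Γ((p+1+iq)/2) Γ((p+1-iq)/2)). -/
open Complex MeasureTheory
open scoped Real FourierTransform

lemma int_aux (s d : ℝ) (hs : 0 < s) (hd : 0 < d) :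
    IntegrableOn (fun x : ℝ => x ^ (s-1) * Real.exp (-(d * x))) (Set.Ioi 0) := by
  have := integrableOn_rpow_mul_exp_neg_mul_rpow (s := s-1) (p := 1) (by linarith) one_pos hd
  simpa using this

lemma norm_aux (a z : ℂ) {x : ℝ} (hx : 0 < x) :
    ‖(x : ℂ) ^ (a-1) * exp (-(z * x))‖ = x ^ (a.re-1) * Real.exp (-(z.re * x)) := by
  rw [norm_mul, norm_exp, norm_cpow_eq_rpow_re_of_pos hx]
  simp

lemma meas_aux (a z : ℂ) :
    AEStronglyMeasurable (fun x : ℝ => (x : ℂ) ^ (a-1) * exp (-(z * x)))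
      (volume.restrict (Set.Ioi 0)) := by
  apply Measurable.aestronglyMeasurable
  fun_prop

lemma cint_aux (a z : ℂ) (ha : 0 < a.re) (hz : 0 < z.re) :
    IntegrableOn (fun x : ℝ => (x : ℂ) ^ (a-1) * exp (-(z * x))) (Set.Ioi 0) := by
  refine (int_aux a.re z.re ha hz).mono' (meas_aux a z) ?_
  filter_upwards [ae_restrict_mem measurableSet_Ioi] with x hx
  rw [norm_aux a z hx]

lemma diff_aux (a z : ℂ) (ha : 0 < a.re) (hz : 0 < z.re) :
    DifferentiableAt ℂ (fun z : ℂ => ∫ x in Set.Ioi (0:ℝ), (x : ℂ) ^ (a-1) * exp (-(z * x))) z := by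
  have hd : 0 < z.re / 2 := by linarith
  refine (hasDerivAt_integral_of_dominated_loc_of_deriv_le
    (F := fun (z : ℂ) (x : ℝ) => (x : ℂ) ^ (a-1) * exp (-(z * x)))
    (F' := fun (z : ℂ) (x : ℝ) => (x : ℂ) ^ (a-1) * (exp (-(z * x)) * (-x)))
    (bound := fun x : ℝ => x ^ ((a.re+1)-1) * Real.exp (-((z.re/2) * x)))
    (Metric.ball_mem_nhds z hd) ?_ (cint_aux a z ha hz) ?_ ?_ ?_ ?_).2.differentiableAt
  · exact Filter.Eventually.of_forall fun w => meas_aux a w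
  · apply Measurable.aestronglyMeasurable
    fun_prop
  · filter_upwards [ae_restrict_mem measurableSet_Ioi] with x hx w hw
    have hx' : 0 < x := hx
    rw [← mul_assoc, norm_mul, norm_aux a w hx, norm_neg, norm_real, Real.norm_of_nonneg hx'.le,
      show x ^ (a.re + 1 - 1) = x ^ (a.re - 1) * x by
        rw [← Real.rpow_add_one hx'.ne']; congr 1; ring, mul_right_comm]
    have : z.re / 2 ≤ w.re := by
      have h1 : |(w - z).re| ≤ ‖w - z‖ := abs_re_le_norm _
      have h2 : ‖w - z‖ < z.re / 2 := by simpa [dist_eq] using hw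
      have h3 := neg_abs_le (w - z).re
      simp only [sub_re] at h1 h3
      linarith
    gcongr
  · exact int_aux _ _ (by linarith) hd
  · filter_upwards with x w hw
    have h : HasDerivAt (fun z : ℂ => -(z * x)) (-(x:ℂ)) w := by
      have h0 := ((hasDerivAt_id w).mul_const (x:ℂ)).fun_neg
      simp only [one_mul, id] at h0
      exact h0
    exact (h.cexp).const_mul _

lemma gamma_laplace (a z : ℂ) (ha : 0 < a.re) (hz : 0 < z.re) :
    ∫ x in Set.Ioi (0:ℝ), (x : ℂ) ^ (a-1) * exp (-(z * x)) = z ^ (-a) * Gamma a := by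
  have hopen : IsOpen {z : ℂ | 0 < z.re} := isOpen_lt continuous_const continuous_re
  have h1 : AnalyticOnNhd ℂ
      (fun z : ℂ => ∫ x in Set.Ioi (0:ℝ), (x : ℂ) ^ (a-1) * exp (-(z * x))) {z | 0 < z.re} :=
    DifferentiableOn.analyticOnNhd
      (fun w hw => (diff_aux a w ha hw).differentiableWithinAt) hopen
  have h2 : AnalyticOnNhd ℂ (fun z : ℂ => z ^ (-a) * Gamma a) {z | 0 < z.re} := by
    refine DifferentiableOn.analyticOnNhd (fun w hw => ?_) hopen
    refine DifferentiableAt.differentiableWithinAt ?_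
    exact (differentiableAt_id.cpow_const (Or.inl hw)).mul_const _
  refine h1.eqOn_of_preconnected_of_frequently_eq h2 (convex_halfSpace_re_gt 0).isPreconnected
    (z₀ := 1) (by simp) ?_ hz
  have hreal : ∀ r : ℝ, 0 < r → ∫ x in Set.Ioi (0:ℝ), (x : ℂ) ^ (a-1) * exp (-((r:ℂ) * x))
      = (r:ℂ) ^ (-a) * Gamma a := by
    intro r hr
    rw [integral_cpow_mul_exp_neg_mul_Ioi ha hr, one_div, inv_cpow, cpow_neg]
    rw [arg_ofReal_of_nonneg hr.le]; exact Real.pi_pos.ne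
  have ht : Filter.Tendsto (fun r : ℝ => (r : ℂ)) (nhdsWithin 1 {1}ᶜ) (nhdsWithin 1 {1}ᶜ) := by
    refine tendsto_nhdsWithin_iff.2 ⟨?_, ?_⟩
    · exact (continuous_ofReal.tendsto' 1 1 (by simp)).mono_left nhdsWithin_le_nhds
    · filter_upwards [self_mem_nhdsWithin] with r hr
      simpa using hr
  refine ht.frequently (Filter.Eventually.frequently ?_)
  have : ∀ᶠ r : ℝ in nhds 1, 0 < r := lt_mem_nhds one_pos
  filter_upwards [nhdsWithin_le_nhds this] with r hr using hreal r hr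

noncomputable def gf (a : ℂ) : ℝ → ℂ :=
  (Set.Ioi (0:ℝ)).indicator (fun x => (x : ℂ) ^ (a-1) * exp (-((1:ℂ) * x)))

lemma gf_integrable (a : ℂ) (ha : 0 < a.re) : Integrable (gf a) :=
  (cint_aux a 1 ha (by simp)).integrable_indicator measurableSet_Ioi

lemma gf_cont (a : ℂ) (ha : 1 < a.re) : Continuous (gf a) := by
  have h : gf a = fun x : ℝ => ((max x 0 : ℝ) : ℂ) ^ (a-1) * exp (-((1:ℂ) * x)) := by
    ext x
    unfold gf
    by_cases hx : 0 < x
    · simp [hx, hx.le]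
    · have hx' : x ≤ 0 := not_lt.1 hx
      have : a - 1 ≠ 0 := by
        intro h
        have := congrArg re h
        simp at this
        linarith
      simp [hx, hx', this]
  rw [h]
  refine Continuous.mul ?_ (by fun_prop)
  exact (continuous_ofReal_cpow_const (y := a-1) (by simpa using ha)).comp
    (continuous_id.max continuous_const)

lemma fourier_gf (a : ℂ) (ha : 0 < a.re) (ξ : ℝ) :
    𝓕 (gf a) ξ = (1 + ((2 * π * ξ : ℝ) : ℂ) * I) ^ (-a) * Gamma a := by
  rw [← gamma_laplace a _ ha (by simp), Real.fourier_eq', ← integral_indicator measurableSet_Ioi]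
  congr 1
  ext x
  unfold gf
  by_cases hx : x ∈ Set.Ioi (0:ℝ)
  · simp only [Set.indicator_of_mem hx, smul_eq_mul]
    rw [mul_left_comm, ← exp_add]
    congr 2
    simp
    ring
  · simp only [Set.indicator_of_notMem hx, smul_zero]

lemma fourierInv_gf (a : ℂ) (ha : 0 < a.re) (ξ : ℝ) :
    𝓕⁻ (gf a) ξ = (1 - ((2 * π * ξ : ℝ) : ℂ) * I) ^ (-a) * Gamma a := by
  rw [Real.fourierInv_eq_fourier_neg, fourier_gf a ha]
  congr 2
  push_cast
  ring

lemma log_aux (t : ℝ) : log (1 + (t:ℂ) * I) = ((1/2 * Real.log (1+t^2) : ℝ) : ℂ) + (Real.arctan t : ℝ) * I := by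
  have hn : ‖1 + (t:ℂ) * I‖ = √(1+t^2) := by
    have := norm_add_mul_I 1 t
    simpa using this
  have hr : arg (1 + (t:ℂ) * I) = Real.arctan t := by
    rw [arg_of_re_nonneg (by simp), hn, Real.arctan_eq_arcsin]; simp
  rw [log, hn, hr, Real.log_sqrt (by positivity)]
  congr 2
  ring

lemma cpow_aux (a : ℂ) (t : ℝ) : (1 + (t:ℂ) * I) ^ (-a) =
    exp ((((1/2 * Real.log (1+t^2) : ℝ) : ℂ) + (Real.arctan t : ℝ) * I) * (-a)) := by
  rw [cpow_def_of_ne_zero, log_aux]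
  intro h
  have := congrArg re h
  simp at this

lemma fint (a : ℂ) (ha : 1 < a.re) : Integrable (fun t : ℝ => (1 + (t:ℂ) * I) ^ (-a)) := by
  have h := integrable_rpow_neg_one_add_norm_sq (E := ℝ) (r := a.re) (μ := volume) (by simpa using ha)
  refine (h.const_mul (Real.exp (π / 2 * |a.im|))).mono' ?_ ?_
  · apply Measurable.aestronglyMeasurable
    fun_prop
  · filter_upwards with t
    have hp : (0:ℝ) < 1 + t^2 := by positivity
    rw [cpow_aux, norm_exp, Real.norm_eq_abs, sq_abs, Real.rpow_def_of_pos hp, ← Real.exp_add]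
    apply Real.exp_le_exp.2
    simp only [mul_re, add_re, add_im, ofReal_re, ofReal_im, I_re, I_im, neg_re, neg_im, mul_im]
    have h1 : |Real.arctan t * a.im| ≤ π / 2 * |a.im| := by
      rw [abs_mul]
      gcongr
      exact abs_le.2 ⟨(Real.neg_pi_div_two_lt_arctan t).le, (Real.arctan_lt_pi_div_two t).le⟩
    have h2 := le_abs_self (Real.arctan t * a.im)
    linarith

lemma fourier_int (a : ℂ) (ha : 1 < a.re) : Integrable (𝓕 (gf a)) := by
  have h := ((fint a ha).comp_mul_left' (R := 2 * π) (by positivity)).mul_const (Gamma a)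
  refine h.congr (Filter.Eventually.of_forall fun ξ => ?_)
  exact (fourier_gf a (by linarith) ξ).symm

lemma fourierInv_int (a : ℂ) (ha : 1 < a.re) : Integrable (𝓕⁻ (gf a)) := by
  have h := (fourier_int a ha).comp_neg
  refine h.congr (Filter.Eventually.of_forall fun ξ => ?_)
  exact (Real.fourierInv_eq_fourier_neg _ ξ).symm

lemma parseval_aux (a b : ℂ) (ha : 1 < a.re) (hb : 1 < b.re) :
    ∫ ξ : ℝ, 𝓕 (gf a) ξ * 𝓕⁻ (gf b) ξ = ∫ x : ℝ, gf a x * gf b x := by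
  have h : ∫ ξ : ℝ, 𝓕 (gf a) ξ • 𝓕⁻ (gf b) ξ = ∫ x : ℝ, gf a x • 𝓕 (𝓕⁻ (gf b)) x := by
    simpa using! VectorFourier.integral_fourierIntegral_smul_eq_flip (L := innerₗ ℝ)
      Real.continuous_fourierChar continuous_inner (gf_integrable a (by linarith)) (fourierInv_int b hb)
  simp only [smul_eq_mul] at h
  rw [h, (gf_cont b hb).fourier_fourierInv_eq (gf_integrable b (by linarith)) (fourier_int b hb)]

lemma rhs_aux (a b : ℂ) (ha : 1 < a.re) (hb : 1 < b.re) :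
    ∫ x : ℝ, gf a x * gf b x = (2:ℂ) ^ (-(a+b-1)) * Gamma (a+b-1) := by
  rw [← gamma_laplace (a+b-1) 2 (by simp; linarith) (by simp), ← integral_indicator measurableSet_Ioi]
  congr 1
  ext x
  unfold gf
  by_cases hx : x ∈ Set.Ioi (0:ℝ)
  · simp only [Set.indicator_of_mem hx]
    have hx' : (x:ℂ) ≠ 0 := by
      have : 0 < x := hx
      exact_mod_cast this.ne'
    rw [mul_mul_mul_comm, ← exp_add, ← cpow_add _ _ hx']
    congr 2 <;> ring
  · simp only [Set.indicator_of_notMem hx, mul_zero]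

theorem omega_one_integral (p q : ℝ) (hp : 1 < p) :
    ((∫ t : ℝ, (1 + t ^ 2) ^ (-(p + 1) / 2) * Real.exp (q * Real.arctan t) : ℝ) : ℂ)
      = (2 : ℂ) ^ ((1 : ℂ) - p) * π * Complex.Gamma p /
          (Complex.Gamma (((p : ℂ) + 1 + q * I) / 2) *
            Complex.Gamma (((p : ℂ) + 1 - q * I) / 2)) := by
  set a : ℂ := ((p : ℂ) + 1 + q * I) / 2 with ha_def
  set b : ℂ := ((p : ℂ) + 1 - q * I) / 2 with hb_def
  have ha : 1 < a.re := by
    simp [ha_def]; linarith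
  have hb : 1 < b.re := by
    simp [hb_def]; linarith
  have hab : a + b - 1 = p := by rw [ha_def, hb_def]; ring
  have hGa : Gamma a ≠ 0 := Gamma_ne_zero_of_re_pos (by linarith)
  have hGb : Gamma b ≠ 0 := Gamma_ne_zero_of_re_pos (by linarith)
  have key := (parseval_aux a b ha hb).trans (rhs_aux a b ha hb)
  rw [hab] at key
  have hpt : ∀ ξ : ℝ, 𝓕 (gf a) ξ * 𝓕⁻ (gf b) ξ = (fun t : ℝ =>
      (((1 + t ^ 2) ^ (-(p + 1) / 2) * Real.exp (q * Real.arctan t) : ℝ) : ℂ)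
        * (Gamma a * Gamma b)) (2 * π * ξ) := by
    intro ξ
    rw [fourier_gf a (by linarith), fourierInv_gf b (by linarith)]
    generalize 2 * π * ξ = t
    have hpos : (0:ℝ) < 1 + t^2 := by positivity
    have h1 : (1 - (t:ℂ) * I) = 1 + ((-t : ℝ) : ℂ) * I := by push_cast; ring
    rw [mul_mul_mul_comm, h1, cpow_aux, cpow_aux, ← exp_add]
    beta_reduce
    congr 1
    rw [Real.rpow_def_of_pos hpos, ← Real.exp_add, ofReal_exp, Real.arctan_neg, neg_sq,
      ha_def, hb_def]
    congr 1
    push_cast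
    linear_combination (-(q:ℂ) * Complex.arctan t) * I_sq
  rw [integral_congr_ae (Filter.Eventually.of_forall hpt), Measure.integral_comp_mul_left (fun t : ℝ =>
      (((1 + t ^ 2) ^ (-(p + 1) / 2) * Real.exp (q * Real.arctan t) : ℝ) : ℂ)
        * (Gamma a * Gamma b)) (2 * π), integral_mul_const, integral_complex_ofReal, abs_of_pos (by positivity), real_smul] at key
  have hpi : (π:ℂ) ≠ 0 := by exact_mod_cast Real.pi_ne_zero
  rw [eq_div_iff (mul_ne_zero hGa hGb), sub_eq_add_neg, cpow_add _ _ two_ne_zero, cpow_one]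
  generalize (∫ t : ℝ, (1 + t ^ 2) ^ (-(p + 1) / 2) * Real.exp (q * Real.arctan t) : ℝ) = J at key ⊢
  push_cast at key ⊢
  field_simp at key
  linear_combination key
end
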